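/- arXiv:2506.03648 — 3 statements merged into one kernel-verified Lean document; each statement's English description precedes it below -/
import Mathlib

section
/- Let y : ℝ → ℝ be differentiable with derivative y', let t₀ ∈ ℝ, and suppose y' has derivative c at t₀. For λ ∈ ℂ \ {0} and τ ∈ ℝ define the 2×2 complex matrices 𝒜(λ, τ) = (4λ⁴ + τ + 2y(τ)²)·σ₃ − i·(4y(τ)λ² + τ + 2y(τ)²)·σ₂ − (2y'(τ)λ + 1/(2λ))·σ₁ and ℬ(λ, τ) = (λ + y(τ)/λ)·σ₃ − (i·y(τ)/λ)·σ₂, where σ₁ = [[0,1],[1,0]], σ₂ = [[0,−i],[i,0]], σ₃ = [[1,0],[0,−1]]. Then the zero-curvature (compatibility) equation ∂_τ𝒜(λ, t₀) − ∂_λℬ(λ, t₀) + 𝒜(λ, t₀)ℬ(λ, t₀) − ℬ(λ, t₀)𝒜(λ, t₀) = 0 holds for every λ ∈ ℂ \ {0} (with ∂_τ𝒜 the entrywise derivative of τ ↦ 𝒜(λ, τ) at t₀, using y'' (t₀) = c, and ∂_λℬ the entrywise derivative of λ ↦ ℬ(λ, t₀)) if and only if c = 6·y(t₀)² + t₀.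 -/
open Matrix

/-- The Pauli matrix `σ₁`. -/
noncomputable def pauli1 : Matrix (Fin 2) (Fin 2) ℂ := !![0, 1; 1, 0]

/-- The Pauli matrix `σ₂`. -/
noncomputable def pauli2 : Matrix (Fin 2) (Fin 2) ℂ := !![0, -Complex.I; Complex.I, 0]

/-- The Pauli matrix `σ₃`. -/
noncomputable def pauli3 : Matrix (Fin 2) (Fin 2) ℂ := !![1, 0; 0, -1]

/-- The matrix `𝒜(λ, τ)` of the PI Lax pair, built from a function `y` with
derivative `yt`. -/
noncomputable def laxA (y yt : ℝ → ℝ) (l : ℂ) (τ : ℝ) : Matrix (Fin 2) (Fin 2) ℂ :=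
  (4 * l ^ 4 + (τ : ℂ) + 2 * (y τ : ℂ) ^ 2) • pauli3
    - (Complex.I * (4 * (y τ : ℂ) * l ^ 2 + (τ : ℂ) + 2 * (y τ : ℂ) ^ 2)) • pauli2
    - (2 * (yt τ : ℂ) * l + 1 / (2 * l)) • pauli1

/-- The matrix `ℬ(λ, τ)` of the PI Lax pair. -/
noncomputable def laxB (y : ℝ → ℝ) (l : ℂ) (τ : ℝ) : Matrix (Fin 2) (Fin 2) ℂ :=
  (l + (y τ : ℂ) / l) • pauli3 - (Complex.I * (y τ : ℂ) / l) • pauli2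

/-- Explicit derivative of `laxA` in `τ`. -/
noncomputable def laxAt (y yt : ℝ → ℝ) (c : ℝ) (l : ℂ) (τ : ℝ) : Matrix (Fin 2) (Fin 2) ℂ :=
  (1 + 4 * (y τ : ℂ) * (yt τ : ℂ)) • pauli3
    - (Complex.I * (4 * (yt τ : ℂ) * l ^ 2 + 1 + 4 * (y τ : ℂ) * (yt τ : ℂ))) • pauli2
    - (2 * (c : ℂ) * l) • pauli1

/-- Explicit derivative of `laxB` in `λ`. -/
noncomputable def laxBl (y : ℝ → ℝ) (l : ℂ) (τ : ℝ) : Matrix (Fin 2) (Fin 2) ℂ :=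
  (1 - (y τ : ℂ) / l ^ 2) • pauli3 + (Complex.I * (y τ : ℂ) / l ^ 2) • pauli2

theorem laxA_hasDerivAt (y yt : ℝ → ℝ) (t₀ c : ℝ)
    (hy : HasDerivAt y (yt t₀) t₀) (hyt : HasDerivAt yt c t₀) (l : ℂ) (i j : Fin 2) :
    HasDerivAt (fun τ : ℝ => laxA y yt l τ i j) (laxAt y yt c l t₀ i j) t₀ := by
  have h0 : HasDerivAt (fun τ : ℝ => (τ : ℂ)) 1 t₀ := by
    simpa using (hasDerivAt_id t₀).ofReal_comp
  have h1 := hy.ofReal_comp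
  have h2 := hyt.ofReal_comp
  have ha := ((h0.const_add (4 * l ^ 4)).add ((h1.pow 2).const_mul 2)).mul_const (pauli3 i j)
  have hb := (((((h1.const_mul 4).mul_const (l ^ 2)).add h0).add
    ((h1.pow 2).const_mul 2)).const_mul Complex.I).mul_const (pauli2 i j)
  have hd := (((h2.const_mul 2).mul_const l).add_const (1 / (2 * l))).mul_const (pauli1 i j)
  refine ((ha.sub hb).sub hd).congr_deriv ?_
  simp [laxAt]
  ring

theorem laxB_hasDerivAt (y : ℝ → ℝ) (t₀ : ℝ) (l : ℂ) (hl : l ≠ 0) (i j : Fin 2) :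
    HasDerivAt (fun μ : ℂ => laxB y μ t₀ i j) (laxBl y l t₀ i j) l := by
  have h0 := hasDerivAt_id l
  have ha := (h0.add ((hasDerivAt_const l (y t₀ : ℂ)).div h0 hl)).mul_const (pauli3 i j)
  have hb := ((hasDerivAt_const l (Complex.I * (y t₀ : ℂ))).div h0 hl).mul_const (pauli2 i j)
  refine (ha.sub hb).congr_deriv ?_
  simp [laxBl]
  ring

theorem lax_curv (y yt : ℝ → ℝ) (t₀ c : ℝ) (l : ℂ) (hl : l ≠ 0) :
    laxAt y yt c l t₀ - laxBl y l t₀ + laxA y yt l t₀ * laxB y l t₀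
      - laxB y l t₀ * laxA y yt l t₀
      = (2 * l * (6 * (y t₀ : ℂ) ^ 2 + t₀ - c)) • pauli1 := by
  have hI := Complex.I_mul_I
  ext i j
  fin_cases i <;> fin_cases j <;>
    simp [laxAt, laxBl, laxA, laxB, pauli1, pauli2, pauli3, Matrix.mul_apply, Fin.sum_univ_two] <;>
    field_simp <;> ring_nf <;> simp [Complex.I_sq] <;> ring

/-- The zero-curvature equation `𝒜_t - ℬ_λ + 𝒜ℬ - ℬ𝒜 = 0` holds at `t₀` for every
`λ ≠ 0` (with the derivatives taken entrywise) if and only if `y'' t₀ = 6 y(t₀)² + t₀`,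
i.e. `y` satisfies Painlevé I at `t₀`. -/
theorem stmt5 (y yt : ℝ → ℝ) (t₀ c : ℝ)
    (hy : ∀ t : ℝ, HasDerivAt y (yt t) t) (hyt : HasDerivAt yt c t₀) :
    (∀ l : ℂ, l ≠ 0 → ∀ At Bl : Matrix (Fin 2) (Fin 2) ℂ,
        (∀ i j, HasDerivAt (fun τ : ℝ => laxA y yt l τ i j) (At i j) t₀) →
        (∀ i j, HasDerivAt (fun μ : ℂ => laxB y μ t₀ i j) (Bl i j) l) →
        At - Bl + laxA y yt l t₀ * laxB y l t₀ - laxB y l t₀ * laxA y yt l t₀ = 0) ↔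
      c = 6 * y t₀ ^ 2 + t₀ := by
  constructor
  · intro h
    have h1 := h 1 one_ne_zero _ _ (laxA_hasDerivAt y yt t₀ c (hy t₀) hyt 1)
      (laxB_hasDerivAt y t₀ 1 one_ne_zero)
    rw [lax_curv y yt t₀ c 1 one_ne_zero] at h1
    have h2 := congrFun (congrFun h1 0) 1
    simp [pauli1] at h2
    have h3 : 6 * y t₀ ^ 2 + t₀ - c = 0 := by exact_mod_cast h2
    linarith
  · intro hc l hl At Bl hA hB
    have eA : At = laxAt y yt c l t₀ := by
      ext i j
      exact (hA i j).unique (laxA_hasDerivAt y yt t₀ c (hy t₀) hyt l i j)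
    have eB : Bl = laxBl y l t₀ := by
      ext i j
      exact (hB i j).unique (laxB_hasDerivAt y t₀ l hl i j)
    rw [eA, eB, lax_curv y yt t₀ c l hl, hc]
    simp
end

section
/- Let t, y, u ∈ ℂ, let U ⊆ ℂ be open with λ ≠ y for all λ ∈ U, and let Φ₁, Φ₂, c : U → ℂ be differentiable functions such that for all λ ∈ U: Φ₁'(λ) = u·Φ₁(λ) + (2λ² + 2yλ − t + 2y²)·Φ₂(λ), Φ₂'(λ) = 2(λ − y)·Φ₁(λ) − u·Φ₂(λ), and c(λ)² = λ − y (so c(λ) ≠ 0 on U). Then the function φ := Φ₂/c is twice differentiable on U and satisfies the scalar second-order equation φ''(λ) = [u² + 4λ³ − 2λt + 2yt − 4y³ + u/(λ − y) + 3/(4(λ − y)²)]·φ(λ) for all λ ∈ U. -/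
/-- Reduction of the folded PI Lax system to a scalar Schrödinger equation: if
`Φ₁' = u Φ₁ + (2λ² + 2yλ - t + 2y²) Φ₂`, `Φ₂' = 2(λ - y) Φ₁ - u Φ₂` on an open set `U`
avoiding `y`, and `c` is a differentiable branch of `(λ - y)^(1/2)` on `U`, then
`φ = Φ₂ / c` is twice differentiable on `U` and satisfies
`φ'' = [u² + 4λ³ - 2λt + 2yt - 4y³ + u/(λ - y) + 3/(4(λ - y)²)] φ`. -/
theorem stmt6 (t y u : ℂ) (U : Set ℂ) (hU : IsOpen U) (hUy : ∀ l ∈ U, l ≠ y)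
    (Φ₁ Φ₂ c : ℂ → ℂ)
    (hΦ₁ : ∀ l ∈ U, HasDerivAt Φ₁
      (u * Φ₁ l + (2 * l ^ 2 + 2 * y * l - t + 2 * y ^ 2) * Φ₂ l) l)
    (hΦ₂ : ∀ l ∈ U, HasDerivAt Φ₂ (2 * (l - y) * Φ₁ l - u * Φ₂ l) l)
    (hc : ∀ l ∈ U, DifferentiableAt ℂ c l)
    (hc2 : ∀ l ∈ U, c l ^ 2 = l - y) :
    ∀ l ∈ U, DifferentiableAt ℂ (fun z => Φ₂ z / c z) l ∧
      DifferentiableAt ℂ (deriv fun z => Φ₂ z / c z) l ∧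
      deriv (deriv fun z => Φ₂ z / c z) l =
        (u ^ 2 + 4 * l ^ 3 - 2 * l * t + 2 * y * t - 4 * y ^ 3 + u / (l - y)
            + 3 / (4 * (l - y) ^ 2)) * (Φ₂ l / c l) := by
  have hc0 : ∀ l ∈ U, c l ≠ 0 := by
    intro l hl h
    have h2 := hc2 l hl
    rw [h] at h2
    apply hUy l hl
    linear_combination -h2
  have hcd : ∀ l ∈ U, HasDerivAt c (1 / (2 * c l)) l := by
    intro l hl
    have h1 := (hc l hl).hasDerivAt
    have h2 := h1.pow 2
    have h3 : HasDerivAt (fun z => z - y) 1 l := (hasDerivAt_id l).sub_const y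
    have h4 : (c ^ 2) =ᶠ[nhds l] (fun z => z - y) := by
      filter_upwards [hU.mem_nhds hl] with z hz
      exact hc2 z hz
    have h5 := h2.unique (h3.congr_of_eventuallyEq h4)
    have h0 := hc0 l hl
    have h6 : deriv c l = 1 / (2 * c l) := by
      field_simp
      norm_num at h5
      linear_combination h5
    rwa [h6] at h1
  have hφ : ∀ l ∈ U, HasDerivAt (fun z => Φ₂ z / c z)
      (2 * (c l * Φ₁ l) - u * (Φ₂ l / c l) - Φ₂ l / c l / (2 * (l - y))) l := by
    intro l hl
    have h0 := hc0 l hl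
    refine ((hΦ₂ l hl).fun_div (hcd l hl) h0).congr_deriv ?_
    rw [← hc2 l hl]
    field_simp
  intro l hl
  have h0 := hc0 l hl
  have hy : l - y ≠ 0 := sub_ne_zero.2 (hUy l hl)
  have hev : (deriv fun z => Φ₂ z / c z) =ᶠ[nhds l] (fun z =>
      2 * (c z * Φ₁ z) - u * (Φ₂ z / c z) - Φ₂ z / c z / (2 * (z - y))) := by
    filter_upwards [hU.mem_nhds hl] with z hz
    exact (hφ z hz).deriv
  have h3 : HasDerivAt (fun z => 2 * (z - y)) (2 * 1) l :=
    ((hasDerivAt_id l).sub_const y).const_mul 2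
  have hmain := ((((hcd l hl).fun_mul (hΦ₁ l hl)).const_mul 2).fun_sub
    ((hφ l hl).const_mul u)).fun_sub
    ((hφ l hl).fun_div h3 (mul_ne_zero two_ne_zero hy))
  have hd := hmain.congr_of_eventuallyEq hev
  refine ⟨(hφ l hl).differentiableAt, hd.differentiableAt, ?_⟩
  rw [hd.deriv]
  have e : l = c l ^ 2 + y := by linear_combination -(hc2 l hl)
  rw [← hc2 l hl]
  generalize c l = k at *
  generalize Φ₁ l = A at *
  generalize Φ₂ l = B at *
  clear hmain hd hev h3 hφ hcd
  rw [e]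
  field_simp
  ring
end

section
/- Let A ∈ ℝ with A < −3·2^(−2/3) and let z₁ > 0 be the largest real root of x³ + A·x + 1 (which is a simple root, and x³ + Ax + 1 > 0 for x > z₁). Then: (i) the improper integral I := ∫_{z₁}^{∞} [√(s³ + As + 1) − s^(3/2) − (A/2)·s^(−1/2)] ds converges (the integrand is integrable on (z₁, ∞)); (ii) setting α₀ := 2I − (4/5)·z₁^(5/2) − 2A·z₁^(1/2), the function x ↦ 2∫_{z₁}^{x} √(s³ + As + 1) ds − (4/5)·x^(5/2) − 2A·x^(1/2) − α₀ is O(x^(−1/2)) as x → +∞. -/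
open Filter Asymptotics MeasureTheory


lemma aux_bound (A s : ℝ) (hs1 : 1 ≤ s) (hsA : |A| ≤ s) (hp : 0 ≤ s ^ 3 + A * s + 1) :
    |Real.sqrt (s ^ 3 + A * s + 1) - s ^ ((3 : ℝ) / 2) - (A / 2) * s ^ (-(1 : ℝ) / 2)|
      ≤ (2 * (1 + A ^ 2)) * s ^ (-(3 : ℝ) / 2) := by
  have hs0 : 0 < s := by linarith
  obtain ⟨t, ht, hts⟩ : ∃ t : ℝ, 0 < t ∧ t ^ 2 = s := ⟨√s, Real.sqrt_pos.2 hs0, Real.sq_sqrt hs0.le⟩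
  have e1 : s ^ ((3 : ℝ) / 2) = t ^ 3 := by
    rw [← hts, ← Real.rpow_natCast, ← Real.rpow_mul ht.le, ← Real.rpow_natCast]; norm_num
  have e2 : s ^ (-(1 : ℝ) / 2) = t⁻¹ := by
    rw [← hts, ← Real.rpow_natCast, ← Real.rpow_mul ht.le, ← Real.rpow_neg_one]; norm_num
  have e3 : s ^ (-(3 : ℝ) / 2) = (t ^ 3)⁻¹ := by
    rw [← e1, ← Real.rpow_neg hs0.le]; norm_num
  rw [e1, e2, e3]
  have hq := Real.sq_sqrt hp
  have hq0 := Real.sqrt_nonneg (s ^ 3 + A * s + 1)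
  set q := Real.sqrt (s ^ 3 + A * s + 1)
  have ht3 : 0 < t ^ 3 := by positivity
  obtain ⟨hA1, hA2⟩ := abs_le.1 hsA
  have hb : t ^ 3 / 2 ≤ t ^ 3 + A / 2 * t⁻¹ := by
    have : t ^ 3 / 2 + A / 2 * t⁻¹ = (s ^ 2 + A) / 2 * t⁻¹ := by
      rw [← hts]; field_simp
    have h2 : 0 ≤ (s ^ 2 + A) / 2 * t⁻¹ := by
      have : 0 ≤ s ^ 2 + A := by nlinarith
      positivity
    linarith
  have hid : (q - t ^ 3 - A / 2 * t⁻¹) * (q + (t ^ 3 + A / 2 * t⁻¹)) = 1 - A ^ 2 / 4 * s⁻¹ := by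
    have : (q - t ^ 3 - A / 2 * t⁻¹) * (q + (t ^ 3 + A / 2 * t⁻¹))
      = q ^ 2 - (t ^ 3 + A / 2 * t⁻¹) ^ 2 := by ring
    rw [this, hq, ← hts]; field_simp; ring
  have hR : |1 - A ^ 2 / 4 * s⁻¹| ≤ 1 + A ^ 2 := by
    have h1 : s⁻¹ ≤ 1 := inv_le_one_of_one_le₀ hs1
    have h0 : 0 < s⁻¹ := by positivity
    rw [abs_le]; constructor <;> nlinarith [sq_nonneg A, mul_nonneg (sq_nonneg A) h0.le]
  rw [← hid, abs_mul] at hR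
  have h3 : t ^ 3 / 2 ≤ |q + (t ^ 3 + A / 2 * t⁻¹)| := le_trans (by linarith) (le_abs_self _)
  have h4 := mul_le_mul_of_nonneg_left h3 (abs_nonneg (q - t ^ 3 - A / 2 * t⁻¹))
  rw [← div_eq_mul_inv _ (t ^ 3), le_div_iff₀ ht3]
  linarith

/-- For `A < -3·2^(-2/3)` and `z₁ > 0` the largest (simple) real root of `x³ + A x + 1`:
(i) the integrand `√(s³ + As + 1) - s^(3/2) - (A/2) s^(-1/2)` is integrable on `(z₁, ∞)`;
(ii) with `α₀ := 2I - (4/5) z₁^(5/2) - 2A z₁^(1/2)` (where `I` is the improper integral),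
`2∫_{z₁}^{x} √(s³ + As + 1) ds - (4/5) x^(5/2) - 2A x^(1/2) - α₀ = O(x^(-1/2))`
as `x → +∞`. -/
theorem stmt8 (A z₁ : ℝ) (hA : A < -3 * (2 : ℝ) ^ (-(2 : ℝ) / 3)) (hz₁ : 0 < z₁)
    (hroot : z₁ ^ 3 + A * z₁ + 1 = 0)
    (hmax : ∀ x : ℝ, x ^ 3 + A * x + 1 = 0 → x ≤ z₁)
    (hsimple : 3 * z₁ ^ 2 + A ≠ 0)
    (hpos : ∀ x : ℝ, z₁ < x → 0 < x ^ 3 + A * x + 1) :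
    IntegrableOn
      (fun s : ℝ => Real.sqrt (s ^ 3 + A * s + 1) - s ^ ((3 : ℝ) / 2)
        - (A / 2) * s ^ (-(1 : ℝ) / 2)) (Set.Ioi z₁) ∧
    (fun x : ℝ =>
        2 * (∫ s in z₁..x, Real.sqrt (s ^ 3 + A * s + 1)) - (4 / 5) * x ^ ((5 : ℝ) / 2)
          - 2 * A * x ^ ((1 : ℝ) / 2)
          - (2 * (∫ s in Set.Ioi z₁,
                (Real.sqrt (s ^ 3 + A * s + 1) - s ^ ((3 : ℝ) / 2)
                  - (A / 2) * s ^ (-(1 : ℝ) / 2)))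
              - (4 / 5) * z₁ ^ ((5 : ℝ) / 2) - 2 * A * z₁ ^ ((1 : ℝ) / 2)))
      =O[atTop] fun x : ℝ => x ^ (-(1 : ℝ) / 2) := by
  classical
  set g : ℝ → ℝ := fun s : ℝ => Real.sqrt (s ^ 3 + A * s + 1) - s ^ ((3 : ℝ) / 2)
        - (A / 2) * s ^ (-(1 : ℝ) / 2) with hg
  have hbd : ∀ s, max z₁ (max 1 |A|) < s → |g s| ≤ (2 * (1 + A ^ 2)) * s ^ (-(3 : ℝ) / 2) := by
    intro s hs
    simp only [max_lt_iff] at hs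
    exact aux_bound A s hs.2.1.le hs.2.2.le (hpos s hs.1).le
  have hc1 : Continuous fun s : ℝ => Real.sqrt (s ^ 3 + A * s + 1) := by fun_prop
  have hcr : ∀ r : ℝ, ContinuousOn (fun s : ℝ => s ^ r) (Set.Ici z₁) := fun r s hs =>
    (Real.continuousAt_rpow_const s r (Or.inl (hz₁.trans_le hs).ne')).continuousWithinAt
  have hcg : ContinuousOn g (Set.Ici z₁) :=
    (hc1.continuousOn.sub (hcr _)).sub (continuousOn_const.mul (hcr _))
  have hO : g =O[atTop] fun s : ℝ => s ^ (-(3 : ℝ) / 2) := by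
    refine IsBigO.of_bound (2 * (1 + A ^ 2)) ?_
    filter_upwards [eventually_gt_atTop (max z₁ (max 1 |A|))] with s hs
    have h0 : 0 < s := hz₁.trans ((le_max_left _ _).trans_lt hs)
    rw [Real.norm_eq_abs, Real.norm_of_nonneg (Real.rpow_nonneg h0.le _)]
    exact hbd s hs
  have hint : IntegrableOn g (Set.Ici z₁) := by
    refine (hcg.locallyIntegrableOn measurableSet_Ici).integrableOn_of_isBigO_atTop hO ?_
    exact ⟨Set.Ioi 1, Ioi_mem_atTop 1, integrableOn_Ioi_rpow_of_lt (by norm_num) one_pos⟩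
  have hintI : IntegrableOn g (Set.Ioi z₁) := hint.mono_set Set.Ioi_subset_Ici_self
  refine ⟨hintI, ?_⟩
  refine IsBigO.of_bound (2 * (2 * (1 + A ^ 2) * 2)) ?_
  filter_upwards [eventually_gt_atTop (max z₁ (max 1 |A|))] with x hx
  have hzx : z₁ < x := (le_max_left _ _).trans_lt hx
  have h0 : 0 < x := hz₁.trans hzx
  have hii : ∀ r : ℝ, IntervalIntegrable (fun s : ℝ => s ^ r) volume z₁ x := fun r =>
    ((hcr r).mono (by rw [Set.uIcc_of_le hzx.le]; exact Set.Icc_subset_Ici_self)).intervalIntegrable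
  have hsplit : ∫ s in z₁..x, g s = (∫ s in z₁..x, Real.sqrt (s ^ 3 + A * s + 1))
      - (x ^ ((5 : ℝ) / 2) - z₁ ^ ((5 : ℝ) / 2)) / (5 / 2)
      - A / 2 * ((x ^ ((1 : ℝ) / 2) - z₁ ^ ((1 : ℝ) / 2)) / (1 / 2)) := by
    rw [hg, intervalIntegral.integral_sub ((hc1.intervalIntegrable _ _).sub (hii _))
      ((hii _).const_mul _), intervalIntegral.integral_sub (hc1.intervalIntegrable _ _) (hii _),
      intervalIntegral.integral_const_mul, integral_rpow (Or.inl (by norm_num)),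
      integral_rpow (Or.inl (by norm_num))]
    norm_num
  have htail : (∫ s in z₁..x, g s) + ∫ s in Set.Ioi x, g s = ∫ s in Set.Ioi z₁, g s :=
    intervalIntegral.integral_interval_add_Ioi hintI (hintI.mono_set (Set.Ioi_subset_Ioi hzx.le))
  have hT : |∫ s in Set.Ioi x, g s| ≤ 2 * (1 + A ^ 2) * 2 * x ^ (-(1 : ℝ) / 2) := by
    have h1 : ‖∫ s in Set.Ioi x, g s‖
        ≤ ∫ s in Set.Ioi x, (2 * (1 + A ^ 2)) * s ^ (-(3 : ℝ) / 2) := by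
      refine norm_integral_le_of_norm_le
        ((integrableOn_Ioi_rpow_of_lt (by norm_num) h0).const_mul _) ?_
      filter_upwards [ae_restrict_mem measurableSet_Ioi] with s hs
      exact hbd s (hx.trans hs)
    rw [integral_const_mul, integral_Ioi_rpow_of_lt (by norm_num) h0] at h1
    rw [← Real.norm_eq_abs]
    refine h1.trans (le_of_eq ?_)
    norm_num
    ring
  rw [Real.norm_eq_abs, Real.norm_of_nonneg (Real.rpow_nonneg h0.le _)]
  have key : 2 * (∫ s in z₁..x, Real.sqrt (s ^ 3 + A * s + 1)) - (4 / 5) * x ^ ((5 : ℝ) / 2)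
          - 2 * A * x ^ ((1 : ℝ) / 2)
          - (2 * (∫ s in Set.Ioi z₁, g s)
              - (4 / 5) * z₁ ^ ((5 : ℝ) / 2) - 2 * A * z₁ ^ ((1 : ℝ) / 2))
      = -2 * ∫ s in Set.Ioi x, g s := by
    rw [← htail, hsplit]; ring
  rw [key, abs_mul]
  norm_num at hT ⊢
  linarith
end
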